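/- arXiv:1512.07970 — 9 statements merged into one kernel-verified Lean document; each statement's English description precedes it below -/
import Mathlib

section
/- Let f : ℝ² → ℝ be a bounded function such that (1) for every x ∈ ℝ the vertical section y ↦ f(x,y) is quasicontinuous and upper semicontinuous, and (2) there exists a countable set B dense in ℝ such that for every y ∈ B the horizontal section x ↦ f(x,y) is Lebesgue measurable. Then f is (L)-sup-measurable, i.e., for every Lebesgue measurable function φ : ℝ → ℝ the function x ↦ f(x, φ(x)) is Lebesgue measurable. -/
open MeasureTheory Set Filter Topology

/-- `g : ℝ → ℝ` is quasicontinuous: for every point `y`, every `ε > 0` and every open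
neighborhood `U` of `y` there is a nonempty open `V ⊆ U` with `|g t − g y| < ε` on `V`. -/
def QuasiContinuous (g : ℝ → ℝ) : Prop :=
  ∀ y : ℝ, ∀ ε : ℝ, 0 < ε → ∀ U : Set ℝ, IsOpen U → y ∈ U →
    ∃ V : Set ℝ, V.Nonempty ∧ IsOpen V ∧ V ⊆ U ∧ ∀ t ∈ V, |g t - g y| < ε

/-- `g` is upper semicontinuous at `y₀` (ε-δ formulation). -/
def UpperSemicontinuousPt (g : ℝ → ℝ) (y₀ : ℝ) : Prop :=
  ∀ ε : ℝ, 0 < ε → ∃ δ : ℝ, 0 < δ ∧ ∀ y : ℝ, |y - y₀| < δ → g y ≤ g y₀ + ε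

/-- Lebesgue measurability: measurability with respect to the completed Lebesgue measure. -/
def LebMeasurable (g : ℝ → ℝ) : Prop :=
  MeasureTheory.NullMeasurable g (volume : Measure ℝ)

/-- Lebesgue measurability on a subset `s` of `ℝ`. -/
def LebMeasurableOn (g : ℝ → ℝ) (s : Set ℝ) : Prop :=
  MeasureTheory.NullMeasurable g ((volume : Measure ℝ).restrict s)

/-- Superlevel sets of a quasicontinuous upper semicontinuous function are determined by its
values on a dense set. -/
lemma le_iff_forall_exists_mem_dense {g : ℝ → ℝ} (hq : QuasiContinuous g) {y : ℝ}
    (hu : UpperSemicontinuousPt g y) {B : Set ℝ} (hB : Dense B) (a : ℝ) :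
    a ≤ g y ↔ ∀ n : ℕ, ∃ b ∈ B, |b - y| < 1 / ((n : ℝ) + 1) ∧ a - 1 / ((n : ℝ) + 1) < g b := by
  constructor
  · intro ha n
    have hn : 0 < 1 / ((n : ℝ) + 1) := Nat.one_div_pos_of_nat
    obtain ⟨V, hVne, hVo, hVU, hV⟩ :=
      hq y _ hn (Metric.ball y (1 / ((n : ℝ) + 1))) Metric.isOpen_ball (Metric.mem_ball_self hn)
    obtain ⟨b, hbV, hbB⟩ := hB.inter_open_nonempty V hVo hVne
    have hby : |b - y| < 1 / ((n : ℝ) + 1) := by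
      simpa [Metric.mem_ball, Real.dist_eq] using hVU hbV
    have hgb := (abs_lt.mp (hV b hbV)).1
    exact ⟨b, hbB, hby, by linarith⟩
  · intro h
    refine le_of_forall_pos_le_add fun ε hε => ?_
    obtain ⟨δ, hδ, hgδ⟩ := hu (ε / 2) (half_pos hε)
    obtain ⟨n, hn⟩ := exists_nat_one_div_lt (lt_min hδ (half_pos hε))
    obtain ⟨hnδ, hnε⟩ := lt_min_iff.mp hn
    obtain ⟨b, -, hby, hgb⟩ := h n
    have := hgδ b (hby.trans hnδ)
    linarith

theorem grande_sup_measurable (f : ℝ → ℝ → ℝ)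
    (M : ℝ) (hbd : ∀ x y : ℝ, |f x y| ≤ M)
    (h1 : ∀ x : ℝ, QuasiContinuous (f x) ∧ ∀ y₀ : ℝ, UpperSemicontinuousPt (f x) y₀)
    (B : Set ℝ) (hBc : B.Countable) (hBd : Dense B)
    (h2 : ∀ y ∈ B, LebMeasurable (fun x => f x y)) :
    ∀ φ : ℝ → ℝ, LebMeasurable φ → LebMeasurable (fun x => f x (φ x)) := by
  intro φ hφ
  refine measurable_of_Ici (δ := NullMeasurableSpace ℝ volume) fun a => ?_
  change NullMeasurableSet ((fun x => f x (φ x)) ⁻¹' Ici a) volume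
  have hset : (fun x => f x (φ x)) ⁻¹' Ici a =
      ⋂ n : ℕ, ⋃ b ∈ B, φ ⁻¹' Metric.ball b (1 / ((n : ℝ) + 1)) ∩
        (fun x => f x b) ⁻¹' Ioi (a - 1 / ((n : ℝ) + 1)) := by
    ext x
    simpa [Real.dist_eq, abs_sub_comm, and_left_comm] using
      le_iff_forall_exists_mem_dense (h1 x).1 ((h1 x).2 (φ x)) hBd a
  rw [hset]
  exact NullMeasurableSet.iInter fun n => NullMeasurableSet.biUnion hBc fun b hb =>
    (hφ measurableSet_ball).inter (h2 b hb measurableSet_Ioi)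
end

section
/- Let g : ℝ → ℝ be quasicontinuous, let I ⊆ ℝ be a nonempty open interval, and let D ⊆ ℝ be a dense set. Then sup_{t ∈ I} g(t) = sup_{t ∈ D ∩ I} g(t), where both suprema are taken in the extended real numbers. -/
open MeasureTheory Set Filter Topology

theorem quasicontinuous_sup_dense (g : ℝ → ℝ) (hg : QuasiContinuous g)
    (I : Set ℝ) (hIo : IsOpen I) (hIc : I.OrdConnected) (hne : I.Nonempty)
    (D : Set ℝ) (hD : Dense D) :
    (⨆ t ∈ I, ((g t : ℝ) : EReal)) = ⨆ t ∈ D ∩ I, ((g t : ℝ) : EReal) := by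
  refine le_antisymm (iSup₂_le fun y hy => le_of_forall_lt fun c hc => ?_)
    (biSup_mono fun t ht => ht.2)
  obtain ⟨x, hcx, hxy⟩ := EReal.lt_iff_exists_real_btwn.1 hc
  have hxy' : x < g y := EReal.coe_lt_coe_iff.1 hxy
  obtain ⟨V, hVne, hVo, hVI, hV⟩ := hg y (g y - x) (sub_pos.2 hxy') I hIo hy
  obtain ⟨t, htV, htD⟩ := hD.inter_open_nonempty V hVo hVne
  have hxt : x < g t := by linarith [(abs_lt.1 (hV t htV)).1]
  exact (hcx.trans (EReal.coe_lt_coe_iff.2 hxt)).trans_le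
    (le_biSup (fun t => ((g t : ℝ) : EReal)) (show t ∈ D ∩ I from ⟨htD, hVI htV⟩))
end

section
/- Let f : ℝ² → ℝ, let A ⊆ ℝ with μ(ℝ ∖ A) = 0 be such that for every x ∈ A the vertical section y ↦ f(x,y) is quasicontinuous, and let B ⊆ ℝ be a dense set such that for every b ∈ B the horizontal section x ↦ f(x,b) is Lebesgue measurable. Then for every nonempty open interval I ⊆ ℝ and every n ∈ ℕ the function γ : ℝ → ℝ defined by γ(x) = min( n , sup_{t ∈ I} f(x,t) ) is Lebesgue measurable. -/
open MeasureTheory Set Filter Topology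

/-- The supremum of a quasicontinuous function over an open set agrees with its supremum over
the points of a dense set lying in it. -/
theorem QuasiContinuous.biSup_eq_of_dense {g : ℝ → ℝ} (hg : QuasiContinuous g)
    {C I : Set ℝ} (hC : Dense C) (hI : IsOpen I) :
    ⨆ t ∈ I, (g t : EReal) = ⨆ t ∈ C ∩ I, (g t : EReal) := by
  refine le_antisymm (iSup₂_le fun y hy => ?_) (biSup_mono fun t ht => ht.2)
  refine EReal.ge_of_forall_gt_iff_ge.mp fun z hz => ?_
  have hzy : z < g y := EReal.coe_lt_coe_iff.mp hz
  obtain ⟨V, hVne, hVo, hVI, hV⟩ := hg y (g y - z) (sub_pos.mpr hzy) I hI hy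
  obtain ⟨t, htV, htC⟩ := hC.inter_open_nonempty V hVo hVne
  have hzt : z ≤ g t := by linarith [(abs_lt.mp (hV t htV)).1]
  exact (EReal.coe_le_coe_iff.mpr hzt).trans
    (le_biSup (fun t => (g t : EReal)) ⟨htC, hVI htV⟩)

theorem truncated_sup_measurable (f : ℝ → ℝ → ℝ)
    (A : Set ℝ) (hA : volume Aᶜ = 0)
    (h1 : ∀ x ∈ A, QuasiContinuous (f x))
    (B : Set ℝ) (hBd : Dense B)
    (h2 : ∀ b ∈ B, LebMeasurable (fun x => f x b))
    (I : Set ℝ) (hIo : IsOpen I) (hIc : I.OrdConnected) (hne : I.Nonempty)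
    (n : ℕ) :
    LebMeasurable (fun x => (min ((n : ℕ) : EReal) (⨆ t ∈ I, ((f x t : ℝ) : EReal))).toReal) := by
  obtain ⟨C, hCB, hCc, hCd⟩ := hBd.exists_countable_dense_subset
  have hsup : AEMeasurable (fun x => ⨆ t ∈ C ∩ I, (f x t : EReal)) volume :=
    AEMeasurable.biSup _ (hCc.mono inter_subset_left) fun t ht =>
      measurable_coe_real_ereal.comp_aemeasurable (h2 t (hCB ht.1)).aemeasurable
  refine AEMeasurable.nullMeasurable (AEMeasurable.congr
    (measurable_ereal_toReal.comp_aemeasurable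
      ((aemeasurable_const (b := ((n : ℕ) : EReal))).min hsup)) ?_)
  filter_upwards [mem_ae_iff.mpr hA] with x hx
  simp only [Function.comp_apply, (h1 x hx).biSup_eq_of_dense hCd hIo]
end

section
/- Let f : [a,b] × [c,d] → ℝ be (L)-sup-measurable (for every Lebesgue measurable φ : [a,b] → [c,d] the function x ↦ f(x,φ(x)) is Lebesgue measurable), suppose there is an integrable function ψ : [a,b] → ℝ with |f(x,y)| ≤ ψ(x) for all (x,y) ∈ [a,b] × [c,d], and let A ⊆ [a,b] with μ([a,b] ∖ A) = 0 be such that for every x ∈ A the vertical section y ↦ f(x,y) is upper semicontinuous. Let (yₙ) be a sequence of Lebesgue measurable functions yₙ : [a,b] → [c,d] converging pointwise on [a,b] to a measurable function y₀ : [a,b] → [c,d]. Then the function z(x) = limsup_{n→∞} f(x, yₙ(x)) satisfies ∫_a^b z(x) dμ(x) ≤ ∫_a^b f(x, y₀(x)) dμ(x). -/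
open MeasureTheory Set Filter Topology

theorem aemeasurable_limsup {α : Type*} [MeasurableSpace α] {μ : Measure α} {u : ℕ → α → ℝ}
    (hu : ∀ n, AEMeasurable (u n) μ) :
    AEMeasurable (fun x => limsup (fun n => u n x) atTop) μ := by
  refine ⟨fun x => limsup (fun n => (hu n).mk (u n) x) atTop,
    Measurable.limsup fun n => (hu n).measurable_mk, ?_⟩
  filter_upwards [ae_all_iff.2 fun n => (hu n).ae_eq_mk] with x hx
  simp only [hx]

theorem abs_limsup_le {u : ℕ → ℝ} {M : ℝ} (hu : ∀ n, -M ≤ u n ∧ u n ≤ M) :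
    |limsup u atTop| ≤ M := by
  refine abs_le.2 ⟨?_, ?_⟩
  · exact le_limsup_of_frequently_le (Frequently.of_forall fun n => (hu n).1)
      (isBoundedUnder_of ⟨M, fun n => (hu n).2⟩)
  · exact limsup_le_of_le (isBoundedUnder_of ⟨-M, fun n => (hu n).1⟩).isCoboundedUnder_le
      (Eventually.of_forall fun n => (hu n).2)

theorem limsup_integral_le (a b c d : ℝ) (hab : a ≤ b) (hcd : c ≤ d) (f : ℝ → ℝ → ℝ)
    (hsup : ∀ φ : ℝ → ℝ, (∀ x ∈ Icc a b, φ x ∈ Icc c d) → LebMeasurableOn φ (Icc a b) →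
      LebMeasurableOn (fun x => f x (φ x)) (Icc a b))
    (ψ : ℝ → ℝ) (hψ : IntegrableOn ψ (Icc a b) volume)
    (hdom : ∀ x ∈ Icc a b, ∀ y ∈ Icc c d, |f x y| ≤ ψ x)
    (A : Set ℝ) (hAsub : A ⊆ Icc a b) (hA : volume (Icc a b \ A) = 0)
    (husc : ∀ x ∈ A, ∀ y₀ ∈ Icc c d, ∀ ε : ℝ, 0 < ε → ∃ δ : ℝ, 0 < δ ∧
      ∀ y ∈ Icc c d, |y - y₀| < δ → f x y ≤ f x y₀ + ε)
    (Y : ℕ → ℝ → ℝ) (hYmem : ∀ n : ℕ, ∀ x ∈ Icc a b, Y n x ∈ Icc c d)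
    (hYm : ∀ n : ℕ, LebMeasurableOn (Y n) (Icc a b))
    (y₀ : ℝ → ℝ) (hy₀mem : ∀ x ∈ Icc a b, y₀ x ∈ Icc c d)
    (hy₀m : LebMeasurableOn y₀ (Icc a b))
    (hconv : ∀ x ∈ Icc a b, Tendsto (fun n => Y n x) atTop (𝓝 (y₀ x))) :
    ∫ x in Icc a b, (Filter.limsup (fun n => f x (Y n x)) atTop) ≤
      ∫ x in Icc a b, f x (y₀ x) := by
  have hAE : ∀ᵐ x ∂volume.restrict (Icc a b), x ∈ A := by
    rw [ae_restrict_iff' measurableSet_Icc, ae_iff]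
    convert hA using 2
    ext x
    simp [and_assoc]
  have hmem : ∀ᵐ x ∂volume.restrict (Icc a b), x ∈ Icc a b :=
    ae_restrict_mem measurableSet_Icc
  have hmeas : ∀ n, AEMeasurable (fun x => f x (Y n x)) (volume.restrict (Icc a b)) :=
    fun n => (hsup (Y n) (hYmem n) (hYm n)).aemeasurable
  have hmeas₀ : AEMeasurable (fun x => f x (y₀ x)) (volume.restrict (Icc a b)) :=
    (hsup y₀ hy₀mem hy₀m).aemeasurable
  have hbound : ∀ x ∈ Icc a b, ∀ n, -ψ x ≤ f x (Y n x) ∧ f x (Y n x) ≤ ψ x :=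
    fun x hx n => abs_le.1 (hdom x hx _ (hYmem n x hx))
  refine integral_mono_ae ?_ ?_ ?_
  · refine hψ.mono' (aemeasurable_limsup hmeas).aestronglyMeasurable ?_
    filter_upwards [hmem] with x hx
    exact abs_limsup_le (hbound x hx)
  · refine hψ.mono' hmeas₀.aestronglyMeasurable ?_
    filter_upwards [hmem] with x hx
    exact hdom x hx _ (hy₀mem x hx)
  · filter_upwards [hmem, hAE] with x hx hxA
    refine le_of_forall_pos_le_add fun ε hε => ?_
    obtain ⟨δ, hδ, h⟩ := husc x hxA (y₀ x) (hy₀mem x hx) ε hε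
    refine limsup_le_of_le
      (isBoundedUnder_of ⟨-ψ x, fun n => (hbound x hx n).1⟩).isCoboundedUnder_le ?_
    filter_upwards [(hconv x hx).eventually (Metric.ball_mem_nhds (y₀ x) hδ)] with n hn
    exact h _ (hYmem n x hx) hn
end

section
/- Let a < b be reals, let f : [a,b] × ℝ → ℝ be (L)-sup-measurable, let A ⊆ [a,b] with μ(A) = b − a, and let φ : [a,b] → ℝ be integrable with |f(x,y)| ≤ φ(x) for every (x,y) ∈ A × ℝ. Fix y₀ ∈ ℝ and define w : [a,b] → ℝ by w(x) = y₀ − ∫_a^x φ(t) dμ(t). Then w(a) = y₀, |w(x₂) − w(x₁)| ≤ ∫_{x₁}^{x₂} φ(t) dμ(t) for all a ≤ x₁ ≤ x₂ ≤ b, and w(x₂) − w(x₁) ≤ ∫_{x₁}^{x₂} f(t, w(t)) dμ(t) for all a ≤ x₁ ≤ x₂ ≤ b. -/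
open MeasureTheory Set Filter Topology

/-- A null measurable property holding on a set of full outer measure holds almost everywhere. -/
theorem ae_of_forall_mem_of_measure_eq_univ {α : Type*} [MeasurableSpace α] {μ : Measure α}
    [IsFiniteMeasure μ] {A : Set α} (hA : μ A = μ univ) {p : α → Prop}
    (hp : NullMeasurableSet {x | p x} μ) (h : ∀ x ∈ A, p x) : ∀ᵐ x ∂μ, p x := by
  rw [ae_iff_measure_eq hp]
  exact le_antisymm (measure_mono (subset_univ _)) (hA ▸ measure_mono h)

theorem lower_barrier_mem (a b : ℝ) (hab : a < b) (f : ℝ → ℝ → ℝ)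
    (hsup : ∀ g : ℝ → ℝ, LebMeasurableOn g (Icc a b) →
      LebMeasurableOn (fun x => f x (g x)) (Icc a b))
    (A : Set ℝ) (hAsub : A ⊆ Icc a b) (hAvol : volume A = ENNReal.ofReal (b - a))
    (φ : ℝ → ℝ) (hφ : IntegrableOn φ (Icc a b) volume)
    (hdom : ∀ x ∈ A, ∀ y : ℝ, |f x y| ≤ φ x)
    (y₀ : ℝ) (w : ℝ → ℝ) (hw : ∀ x : ℝ, w x = y₀ - ∫ t in a..x, φ t) :
    w a = y₀ ∧
    (∀ x₁ ∈ Icc a b, ∀ x₂ ∈ Icc a b, x₁ ≤ x₂ → |w x₂ - w x₁| ≤ ∫ t in x₁..x₂, φ t) ∧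
    (∀ x₁ ∈ Icc a b, ∀ x₂ ∈ Icc a b, x₁ ≤ x₂ → w x₂ - w x₁ ≤ ∫ t in x₁..x₂, f t (w t)) := by
  have hA : volume.restrict (Icc a b) A = volume.restrict (Icc a b) univ := by
    rw [Measure.restrict_apply' measurableSet_Icc, inter_eq_left.mpr hAsub, hAvol]
    simp
  have hφm : AEMeasurable φ (volume.restrict (Icc a b)) := hφ.aemeasurable
  have hwc : ContinuousOn w (Icc a b) := by
    have h := intervalIntegral.continuousOn_primitive_interval (μ := volume) (f := φ)
      (a := a) (b := b) (by rwa [uIcc_of_le hab.le])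
    rw [uIcc_of_le hab.le] at h
    exact (continuousOn_const.sub h).congr fun x _ => hw x
  have hfm : AEMeasurable (fun x => f x (w x)) (volume.restrict (Icc a b)) :=
    (hsup w (hwc.aemeasurable measurableSet_Icc).nullMeasurable).aemeasurable
  have hbound : ∀ᵐ x ∂volume.restrict (Icc a b), |f x (w x)| ≤ φ x :=
    ae_of_forall_mem_of_measure_eq_univ hA (nullMeasurableSet_le hfm.abs hφm)
      fun x hx => hdom x hx _
  have hfi : IntegrableOn (fun x => f x (w x)) (Icc a b) :=
    Integrable.mono' hφ hfm.aestronglyMeasurable hbound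
  have hint {g : ℝ → ℝ} (hg : IntegrableOn g (Icc a b)) {x₁ x₂ : ℝ} (h₁ : x₁ ∈ Icc a b)
      (h₂ : x₂ ∈ Icc a b) : IntervalIntegrable g volume x₁ x₂ :=
    (hg.mono_set (uIcc_subset_Icc h₁ h₂)).intervalIntegrable
  have ha : a ∈ Icc a b := left_mem_Icc.mpr hab.le
  have hdiff {x₁ x₂ : ℝ} (h₁ : x₁ ∈ Icc a b) (h₂ : x₂ ∈ Icc a b) :
      w x₂ - w x₁ = -∫ t in x₁..x₂, φ t := by
    rw [hw, hw, ← intervalIntegral.integral_interval_sub_left (hint hφ ha h₂) (hint hφ ha h₁)]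
    ring
  refine ⟨by simp [hw], fun x₁ h₁ x₂ h₂ h₁₂ => ?_, fun x₁ h₁ x₂ h₂ h₁₂ => ?_⟩
  · rw [hdiff h₁ h₂, abs_neg, abs_of_nonneg]
    refine intervalIntegral.integral_nonneg_of_ae_restrict h₁₂ ?_
    filter_upwards [ae_restrict_of_ae_restrict_of_subset (Icc_subset_Icc h₁.1 h₂.2) hbound]
      with x hx using (abs_nonneg _).trans hx
  · rw [hdiff h₁ h₂, ← intervalIntegral.integral_neg]
    refine intervalIntegral.integral_mono_ae_restrict h₁₂ (hint hφ h₁ h₂).neg (hint hfi h₁ h₂) ?_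
    filter_upwards [ae_restrict_of_ae_restrict_of_subset (Icc_subset_Icc h₁.1 h₂.2) hbound]
      with x hx using (abs_le.mp hx).1
end

section
/- Let a < b be reals and let 𝒜 be a nonempty set of continuous functions from [a,b] to ℝ which is linearly ordered by the pointwise order (for any u, v ∈ 𝒜, either u(x) ≤ v(x) for all x, or v(x) ≤ u(x) for all x), is uniformly bounded (there exists M with |z(x)| ≤ M for all z ∈ 𝒜 and x ∈ [a,b]), and has no greatest element. Then there exists a sequence (wₙ) in 𝒜 which is nondecreasing in the pointwise order and such that for every x ∈ [a,b], lim_{n→∞} wₙ(x) = sup_{z ∈ 𝒜} z(x). -/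
open MeasureTheory Set Filter Topology

theorem chain_pointwise_sup_sequence (a b : ℝ) (hab : a < b)
    (𝒜 : Set (ℝ → ℝ)) (hne : 𝒜.Nonempty)
    (hcont : ∀ z ∈ 𝒜, ContinuousOn z (Icc a b))
    (hlin : ∀ u ∈ 𝒜, ∀ v ∈ 𝒜, (∀ x ∈ Icc a b, u x ≤ v x) ∨ (∀ x ∈ Icc a b, v x ≤ u x))
    (M : ℝ) (hbd : ∀ z ∈ 𝒜, ∀ x ∈ Icc a b, |z x| ≤ M)
    (hnogreat : ¬ ∃ w ∈ 𝒜, ∀ z ∈ 𝒜, ∀ x ∈ Icc a b, z x ≤ w x) :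
    ∃ w : ℕ → ℝ → ℝ, (∀ n : ℕ, w n ∈ 𝒜) ∧
      (∀ n : ℕ, ∀ x ∈ Icc a b, w n x ≤ w (n + 1) x) ∧
      (∀ x ∈ Icc a b, Tendsto (fun n => w n x) atTop (𝓝 (⨆ z : 𝒜, (z : ℝ → ℝ) x))) := by
  have hintegrable : ∀ z ∈ 𝒜, IntervalIntegrable z volume a b := fun z hz =>
    (hcont z hz).intervalIntegrable_of_Icc hab.le
  let I : (ℝ → ℝ) → ℝ := fun z => ∫ x in a..b, z x
  have le_of_integral_lt : ∀ u ∈ 𝒜, ∀ v ∈ 𝒜, I u < I v → ∀ x ∈ Icc a b, u x ≤ v x := by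
    intro u hu v hv huv
    refine (hlin u hu v hv).resolve_right fun h => huv.not_ge ?_
    exact intervalIntegral.integral_mono_on hab.le (hintegrable v hv) (hintegrable u hu) h
  have exists_integral_lt : ∀ u ∈ 𝒜, ∃ v ∈ 𝒜, I u < I v := by
    intro u hu
    by_contra! h
    refine hnogreat ⟨u, hu, fun z hz x hx => ?_⟩
    by_contra! hlt
    have huz : ∀ y ∈ Icc a b, u y ≤ z y :=
      (hlin u hu z hz).resolve_right fun hzu => hlt.not_ge (hzu x hx)
    exact (h z hz).not_gt <|
      intervalIntegral.integral_lt_integral_of_continuousOn_of_le_of_exists_lt hab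
        (hcont u hu) (hcont z hz) (fun y hy => huz y (Ioc_subset_Icc_self hy)) ⟨x, hx, hlt⟩
  have hbdd : BddAbove (I '' 𝒜) := by
    refine ⟨∫ _ in a..b, M, ?_⟩
    rintro _ ⟨z, hz, rfl⟩
    exact intervalIntegral.integral_mono_on hab.le (hintegrable z hz) intervalIntegrable_const
      fun x hx => (le_abs_self _).trans (hbd z hz x hx)
  have hlub : IsLUB (I '' 𝒜) (sSup (I '' 𝒜)) := isLUB_csSup (hne.image I) hbdd
  have hnotMem : sSup (I '' 𝒜) ∉ I '' 𝒜 := by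
    rintro ⟨u, hu, hu_eq⟩
    obtain ⟨v, hv, huv⟩ := exists_integral_lt u hu
    exact huv.not_ge (hu_eq ▸ hlub.1 (mem_image_of_mem I hv))
  obtain ⟨J, hJmono, -, hJlim, hJmem⟩ :=
    hlub.exists_seq_strictMono_tendsto_of_notMem hnotMem (hne.image I)
  choose w hw hwJ using hJmem
  have hstep : ∀ n, ∀ x ∈ Icc a b, w n x ≤ w (n + 1) x := fun n =>
    le_of_integral_lt _ (hw n) _ (hw (n + 1)) (by simpa only [hwJ] using hJmono n.lt_succ_self)
  refine ⟨w, hw, hstep, fun x hx => ?_⟩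
  have hbddx : BddAbove (range fun z : 𝒜 => (z : ℝ → ℝ) x) := by
    refine ⟨M, ?_⟩
    rintro _ ⟨z, rfl⟩
    exact (le_abs_self _).trans (hbd z z.2 x hx)
  have : Nonempty 𝒜 := hne.to_subtype
  refine tendsto_atTop_isLUB (monotone_nat_of_le_succ fun n => hstep n x hx) ⟨?_, ?_⟩
  · rintro _ ⟨n, rfl⟩
    exact le_ciSup hbddx ⟨w n, hw n⟩
  · refine fun c hc => ciSup_le fun z => ?_
    have hz : I z < sSup (I '' 𝒜) :=
      (hlub.1 (mem_image_of_mem I z.2)).lt_of_ne fun h => hnotMem ⟨z, z.2, h⟩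
    obtain ⟨n, hn⟩ := (hJlim.eventually_const_lt hz).exists
    exact (le_of_integral_lt z z.2 (w n) (hw n) (by rwa [hwJ]) x hx).trans (hc ⟨n, rfl⟩)
end

section
/- Let f : ℝ → ℝ be defined by f(y) = −1 for y > 0 and f(y) = 1 for y ≤ 0. Then for every x₀ ∈ ℝ and every y₀ ∈ ℝ there is no continuous function y : ℝ → ℝ such that y(x) = y₀ + ∫_{x₀}^x f(y(t)) dt for every x ∈ ℝ; that is, the Cauchy problem y′(x) = f(y(x)), y(x₀) = y₀, has no Caratheodory solution y : ℝ → ℝ for any initial condition. -/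
open MeasureTheory Set Filter Topology

/-- If `y` is an integral of `g ∘ y` and `g ∘ y` is constantly `c` on `(a, b]`, then `y`
increases by `(b - a) * c` from `a` to `b`. -/
theorem sub_eq_of_eqOn_Ioc {g y : ℝ → ℝ} {a b c : ℝ} (hab : a ≤ b)
    (hy : y b - y a = ∫ t in a..b, g (y t)) (hc : ∀ t ∈ Ioc a b, g (y t) = c) :
    y b - y a = (b - a) * c := by
  have hconst : ∫ t in a..b, g (y t) = ∫ _ in a..b, c :=
    intervalIntegral.integral_congr_ae
      (Eventually.of_forall fun t ht => hc t (by rwa [uIoc_of_le hab] at ht))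
  rw [hy, hconst, intervalIntegral.integral_const, smul_eq_mul]

theorem step_function_no_solution_any_initial (f : ℝ → ℝ)
    (hf : ∀ y : ℝ, f y = if 0 < y then -1 else 1) :
    ∀ x₀ y₀ : ℝ, ¬ ∃ y : ℝ → ℝ, Continuous y ∧ ∀ x : ℝ, y x = y₀ + ∫ t in x₀..x, f (y t) := by
  rintro x₀ y₀ ⟨y, hcont, hsol⟩
  have hneg : ∀ t, 0 < y t → f (y t) = -1 := fun t ht => by rw [hf, if_pos ht]
  have hpos : ∀ t, y t ≤ 0 → f (y t) = 1 := fun t ht => by rw [hf, if_neg ht.not_gt]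
  have hmeas : Measurable f := by
    rw [funext hf]
    exact Measurable.ite measurableSet_Ioi measurable_const measurable_const
  have hint : ∀ a b : ℝ, IntervalIntegrable (fun t => f (y t)) volume a b := fun a b =>
    (intervalIntegrable_const (c := (1 : ℝ))).mono_fun
      (hmeas.comp hcont.measurable).aestronglyMeasurable
      (Eventually.of_forall fun t => by
        show ‖f (y t)‖ ≤ ‖(1 : ℝ)‖
        rw [hf]
        split_ifs <;> simp)
  have hincr : ∀ a b : ℝ, y b - y a = ∫ t in a..b, f (y t) := fun a b => by
    rw [hsol a, hsol b, add_sub_add_left_eq_sub,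
      intervalIntegral.integral_interval_sub_left (hint _ _) (hint _ _)]
  obtain ⟨a, ha⟩ : ∃ a, y a ≤ 0 := by
    by_contra! h
    have := sub_eq_of_eqOn_Ioc (h 0).le (hincr 0 (y 0)) fun t _ => hneg t (h t)
    linarith [h (y 0)]
  have hstay : ∀ b, a ≤ b → y b ≤ 0 := by
    intro b hab
    by_contra! hb
    -- the last time in `[a, b]` at which `y` is nonpositive
    obtain ⟨s, ⟨⟨has, hsb⟩, hs⟩, hmax⟩ :=
      (isCompact_Icc.inter_right (isClosed_Iic.preimage hcont)).exists_isGreatest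
        (⟨a, left_mem_Icc.2 hab, ha⟩ : (Icc a b ∩ y ⁻¹' Iic 0).Nonempty)
    have := sub_eq_of_eqOn_Ioc hsb (hincr s b) fun t ht => hneg t <| by
      by_contra! hle
      exact ht.1.not_ge (hmax ⟨⟨has.trans ht.1.le, ht.2⟩, hle⟩)
    linarith [show y s ≤ 0 from hs]
  have hle : a ≤ a - y a + 1 := by linarith
  have := sub_eq_of_eqOn_Ioc hle (hincr a _) fun t ht => hpos t (hstay t ht.1.le)
  linarith [hstay _ hle]
end

section
/- The function f : ℝ → ℝ defined by f(y) = 1 for y ≤ 0 and f(y) = sin(π/y) for y > 0 is upper semicontinuous, quasicontinuous, and has the Darboux property (for every interval X ⊆ ℝ the image f(X) is an interval). -/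
open MeasureTheory Set Filter Topology

/-- The sine curve `t ↦ sin (π / t)` attains the value `1` arbitrarily close to `0` from the
right. -/
lemma exists_sin_pi_div_eq_one {δ : ℝ} (hδ : 0 < δ) :
    ∃ t : ℝ, 0 < t ∧ t < δ ∧ Real.sin (Real.pi / t) = 1 := by
  obtain ⟨n, hn⟩ := exists_nat_gt (1 / δ)
  have hpos : (0 : ℝ) < 2 * n + 1 / 2 := by positivity
  refine ⟨1 / (2 * n + 1 / 2), by positivity, ?_, ?_⟩
  · rw [div_lt_comm₀ hpos hδ]
    have : (0 : ℝ) ≤ n := by positivity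
    linarith
  · have h : Real.pi / (1 / (2 * (n : ℝ) + 1 / 2)) = Real.pi / 2 + n * (2 * Real.pi) := by
      field_simp
      ring
    rw [h, Real.sin_add_nat_mul_two_pi, Real.sin_pi_div_two]

theorem sine_function_usc_qc_darboux (f : ℝ → ℝ)
    (hf : ∀ y : ℝ, f y = if y ≤ 0 then 1 else Real.sin (Real.pi / y)) :
    (∀ y₀ : ℝ, UpperSemicontinuousPt f y₀) ∧ QuasiContinuous f ∧
      ∀ X : Set ℝ, X.OrdConnected → (f '' X).OrdConnected := by
  have f_nonpos : ∀ {y : ℝ}, y ≤ 0 → f y = 1 := fun {y} hy => by rw [hf, if_pos hy]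
  have f_pos : ∀ {y : ℝ}, 0 < y → f y = Real.sin (Real.pi / y) := fun {y} hy => by
    rw [hf, if_neg hy.not_ge]
  have f_le_one : ∀ y, f y ≤ 1 := fun y => by
    rcases le_or_gt y 0 with hy | hy
    · exact (f_nonpos hy).le
    · exact (f_pos hy).trans_le (Real.sin_le_one _)
  have cont_pos : ∀ {y : ℝ}, 0 < y → ContinuousAt f y := fun {y} hy => by
    have h : ContinuousAt (fun t : ℝ => Real.sin (Real.pi / t)) y :=
      Real.continuous_sin.continuousAt.comp (continuousAt_const.div continuousAt_id hy.ne')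
    refine h.congr ?_
    filter_upwards [lt_mem_nhds hy] with t ht using (f_pos ht).symm
  have cont_neg : ∀ {y : ℝ}, y < 0 → ContinuousAt f y := fun {y} hy => by
    refine (continuousAt_const (y := (1 : ℝ))).congr ?_
    filter_upwards [gt_mem_nhds hy] with t ht using (f_nonpos (le_of_lt ht)).symm
  have exists_one : ∀ {δ : ℝ}, 0 < δ → ∃ t, 0 < t ∧ t < δ ∧ f t = 1 := fun hδ => by
    obtain ⟨t, ht, htδ, h⟩ := exists_sin_pi_div_eq_one hδ
    exact ⟨t, ht, htδ, (f_pos ht).trans h⟩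
  refine ⟨fun y₀ ε hε => ?_, fun y ε hε U hU hyU => ?_, fun X hX => ?_⟩
  · rcases le_or_gt y₀ 0 with hy | hy
    · exact ⟨1, one_pos, fun y _ => by linarith [f_le_one y, f_nonpos hy]⟩
    · obtain ⟨δ, hδ, h⟩ := Metric.continuousAt_iff.1 (cont_pos hy) ε hε
      refine ⟨δ, hδ, fun y hyδ => ?_⟩
      have := (abs_lt.1 (h (x := y) hyδ)).2
      linarith
  · obtain ⟨t, htU, hty, ht⟩ : ∃ t ∈ U, f t = f y ∧ ContinuousAt f t := by
      rcases lt_trichotomy y 0 with hy | rfl | hy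
      · exact ⟨y, hyU, rfl, cont_neg hy⟩
      · obtain ⟨δ, hδ, hball⟩ := Metric.isOpen_iff.1 hU 0 hyU
        obtain ⟨t, ht, htδ, h⟩ := exists_one hδ
        refine ⟨t, hball ?_, h.trans (f_nonpos le_rfl).symm, cont_pos ht⟩
        rwa [Metric.mem_ball, Real.dist_0_eq_abs, abs_of_pos ht]
      · exact ⟨y, hyU, rfl, cont_pos hy⟩
    obtain ⟨V, hV, hVo, htV⟩ := mem_nhds_iff.1
      (inter_mem (hU.mem_nhds htU) (ht (Metric.ball_mem_nhds (f t) hε)))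
    refine ⟨V, ⟨t, htV⟩, hVo, fun s hs => (hV hs).1, fun s hs => ?_⟩
    rw [← hty]
    exact (hV hs).2
  · have ivt_pos : ∀ {a b : ℝ}, 0 < a → 0 < b → uIcc (f a) (f b) ⊆ f '' uIcc a b :=
      fun ha hb => intermediate_value_uIcc fun t ht =>
        (cont_pos ((lt_min ha hb).trans_le ht.1)).continuousWithinAt
    have ivt_nonpos_pos : ∀ {a b : ℝ}, a ≤ 0 → 0 < b → uIcc (f a) (f b) ⊆ f '' uIcc a b :=
      fun {a b} ha hb => by
        obtain ⟨t, ht, htb, h⟩ := exists_one hb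
        rw [f_nonpos ha, ← h]
        refine (ivt_pos ht hb).trans (image_mono (uIcc_subset_uIcc ?_ right_mem_uIcc))
        exact mem_uIcc_of_le (ha.trans ht.le) htb.le
    refine ⟨?_⟩
    rintro _ ⟨u, hu, rfl⟩ _ ⟨v, hv, rfl⟩
    have ivt : uIcc (f u) (f v) ⊆ f '' uIcc u v := by
      rcases le_or_gt u 0 with hu0 | hu0 <;> rcases le_or_gt v 0 with hv0 | hv0
      · rw [f_nonpos hu0, f_nonpos hv0, uIcc_self, singleton_subset_iff]
        exact ⟨u, left_mem_uIcc, f_nonpos hu0⟩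
      · exact ivt_nonpos_pos hu0 hv0
      · rw [uIcc_comm (f u), uIcc_comm u]
        exact ivt_nonpos_pos hv0 hu0
      · exact ivt_pos hu0 hv0
    exact Icc_subset_uIcc.trans (ivt.trans (image_mono (hX.uIcc_subset hu hv)))
end

section
/- Let f : ℝ → ℝ be defined by f(y) = 1 for y ≤ 0 and f(y) = sin(π/y) for y > 0. Then there is no continuous function y₀ : ℝ → ℝ such that y₀(x) = ∫_0^x f(y₀(t)) dt for every x ∈ ℝ; that is, the Cauchy problem y′(x) = f(y(x)), y(0) = 0, has no Caratheodory solution on ℝ. -/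
open MeasureTheory Set Filter Topology

/-- A function starting below a level `c` and ending above it cannot have negative derivative
at every point where it takes the value `c`. -/
theorem le_of_hasDerivAt_neg_on_level {y : ℝ → ℝ} (hy : Continuous y) {a b c d : ℝ} (hab : a ≤ b)
    (ha : y a < c) (hd : d < 0) (hder : ∀ s, y s = c → HasDerivAt y d s) : y b ≤ c := by
  by_contra! hb
  have hcompact : IsCompact (Icc a b ∩ y ⁻¹' {c}) :=
    isCompact_Icc.inter_right (isClosed_singleton.preimage hy)
  obtain ⟨t, ht, htc⟩ := intermediate_value_Icc hab hy.continuousOn ⟨ha.le, hb.le⟩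
  obtain ⟨s, ⟨hs, hsc⟩, hmin⟩ := hcompact.exists_isLeast ⟨t, ht, htc⟩
  have hsc : y s = c := hsc
  have has : a < s := lt_of_le_of_ne hs.1 (by rintro rfl; exact ha.ne hsc)
  have hbelow : ∀ t ∈ Ioo a s, y t < c := by
    intro t ht
    by_contra! htc
    obtain ⟨r, hr, hrc⟩ := intermediate_value_Icc ht.1.le hy.continuousOn ⟨ha.le, htc⟩
    have : s ≤ r := hmin ⟨⟨hr.1, hr.2.trans (ht.2.le.trans hs.2)⟩, hrc⟩
    linarith [hr.2, ht.2]
  have hslope := (hasDerivWithinAt_iff_tendsto_slope' self_notMem_Iio).1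
    (hder s hsc).hasDerivWithinAt
  obtain ⟨t, ht, hts⟩ :=
    ((hslope.eventually_lt_const hd).and (Ioo_mem_nhdsLT has)).exists
  rw [slope_def_field] at ht
  have := div_nonneg_of_nonpos (a := y t - y s) (b := t - s)
    (by linarith [hbelow t hts]) (by linarith [hts.2])
  linarith

/-- The points `2 / (4 k + 3)`, at which `sin (π / ·)` equals `-1`, accumulate at `0` from above. -/
theorem exists_pos_lt_sin_pi_div_eq_neg_one {ε : ℝ} (hε : 0 < ε) :
    ∃ c, 0 < c ∧ c < ε ∧ Real.sin (Real.pi / c) = -1 := by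
  obtain ⟨k, hk⟩ := exists_nat_gt (1 / ε)
  refine ⟨2 / (4 * k + 3), by positivity, ?_, ?_⟩
  · rw [div_lt_iff₀ hε] at hk
    rw [div_lt_iff₀ (by positivity)]
    nlinarith
  · have h : Real.pi / (2 / (4 * k + 3)) = -(Real.pi / 2) + ((k + 1 : ℕ) : ℝ) * (2 * Real.pi) := by
      push_cast
      field_simp
      ring
    rw [h, Real.sin_add_nat_mul_two_pi, Real.sin_neg, Real.sin_pi_div_two]

theorem sine_function_no_solution (f : ℝ → ℝ)
    (hf : ∀ y : ℝ, f y = if y ≤ 0 then 1 else Real.sin (Real.pi / y)) :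
    ¬ ∃ y₀ : ℝ → ℝ, Continuous y₀ ∧ ∀ x : ℝ, y₀ x = ∫ t in (0:ℝ)..x, f (y₀ t) := by
  rintro ⟨y, hy, hint⟩
  have hfm : Measurable f := by
    rw [funext hf]
    exact Measurable.ite measurableSet_Iic measurable_const (by fun_prop)
  have hfy : Measurable fun t => f (y t) := hfm.comp hy.measurable
  have hbound : ∀ z, ‖f z‖ ≤ 1 := by
    intro z
    rw [hf]
    split_ifs
    · simp
    · exact Real.abs_sin_le_one _
  have hintegrable : ∀ a b, IntervalIntegrable (fun t => f (y t)) volume a b := fun a b =>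
    (intervalIntegrable_const (c := (1 : ℝ))).mono_fun hfy.aestronglyMeasurable
      (Eventually.of_forall fun t => by simpa using hbound (y t))
  have hzero : y 0 = 0 := by simp [hint 0]
  have hderiv : ∀ s, 0 < y s → HasDerivAt y (f (y s)) s := by
    intro s hs
    have hsin : ContinuousAt (fun z => Real.sin (Real.pi / z)) (y s) :=
      Real.continuous_sin.continuousAt.comp (continuousAt_const.div continuousAt_id hs.ne')
    have hfc : ContinuousAt f (y s) := hsin.congr <| by
      filter_upwards [lt_mem_nhds hs] with z hz
      rw [hf, if_neg hz.not_ge]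
    have := intervalIntegral.integral_hasDerivAt_right (hintegrable 0 s)
      hfy.stronglyMeasurable.stronglyMeasurableAtFilter (hfc.comp hy.continuousAt)
    rwa [← funext hint] at this
  have hnonpos : ∀ x, 0 ≤ x → y x ≤ 0 := by
    intro x hx
    by_contra! hpos
    obtain ⟨c, hc, hcx, hsin⟩ := exists_pos_lt_sin_pi_div_eq_neg_one hpos
    refine hcx.not_ge (le_of_hasDerivAt_neg_on_level hy hx (hzero.trans_lt hc) neg_one_lt_zero ?_)
    rintro s rfl
    have := hderiv s hc
    rwa [hf, if_neg hc.not_ge, hsin] at this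
  have hone : y 1 = 1 := by
    rw [hint 1, intervalIntegral.integral_congr (g := fun _ => (1 : ℝ))]
    · simp
    · intro t ht
      rw [uIcc_of_le zero_le_one] at ht
      simp [hf, hnonpos t ht.1]
  linarith [hnonpos 1 zero_le_one]
end
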